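/- arXiv:2304.09654 — 5 statements merged into one kernel-verified Lean document; each statement's English description precedes it below -/
import Mathlib

section
/- Let D = (d, T) with d = (d_1, …, d_n), M = Σ_i d_i even, and T ≥ 1. If G and G' are temporal multigraphs matching D with W(G) = W(G'), then the number of temporal configurations of D whose corresponding temporal multigraph is G equals the number of temporal configurations of D whose corresponding temporal multigraph is G'. Consequently, the temporal multigraph output by sampling a uniformly random temporal configuration of D is uniformly distributed on each set S(W) of matching temporal multigraphs with a fixed tensor W. -/
/-- The set `P` of labeled points: cell `P i` consists of `d i` points. -/
abbrev TPoint (n : ℕ) (d : Fin n → ℕ) : Type := (i : Fin n) × Fin (d i)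

/-- A temporal configuration of `(d, T)`: a partition of the points into pairs
(encoded as a fixed-point-free involution `pair`) together with a timestamp in `[1, T]`
(encoded as `Fin T`) assigned to each pair (encoded as a function on points that is
constant on each matched pair). -/
structure TConfig (n : ℕ) (d : Fin n → ℕ) (T : ℕ) where
  pair : TPoint n d → TPoint n d
  stamp : TPoint n d → Fin T
  invol : Function.Involutive pair
  nofix : ∀ x, pair x ≠ x
  compat : ∀ x, stamp (pair x) = stamp x
/-- The temporal multiplicity of the edge `({v i, v j}, t)` in the temporal multigraph
corresponding to a temporal configuration: for `i ≠ j`, each matched pair with one point in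
cell `i` and one in cell `j` and timestamp `t` is witnessed by exactly one point `x` with
`x.1 = i`; a loop at `i` is witnessed by two such points, whence the division by `2`. -/
noncomputable def configGraph {n T : ℕ} {d : Fin n → ℕ} (c : TConfig n d T)
    (i j : Fin n) (t : Fin T) : ℕ :=
  if i = j then
    Nat.card {x : TPoint n d // x.1 = i ∧ (c.pair x).1 = i ∧ c.stamp x = t} / 2
  else
    Nat.card {x : TPoint n d // x.1 = i ∧ (c.pair x).1 = j ∧ c.stamp x = t}

/-- The degree of node `i` in the temporal multigraph given by a symmetric temporal
multiplicity function `w` (a loop contributes `2` to the degree). -/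
def tmDegree {n T : ℕ} (w : Fin n → Fin n → Fin T → ℕ) (i : Fin n) : ℕ :=
  (∑ j, ∑ t, w i j t) + ∑ t, w i i t

/-- The tensor `W(G)` of a temporal multigraph given by its symmetric temporal multiplicity
function: the diagonal entry `(i,i,t)` is the multiplicity of the loop `({v i}, t)`, and the
off-diagonal entry `(i,j,t)` is the temporal multiplicity `w i j t` if it is at least 2,
and `0` otherwise. -/
def Wtensor {n T : ℕ} (w : Fin n → Fin n → Fin T → ℕ) (i j : Fin n) (t : Fin T) : ℕ :=
  if i = j then w i i t else if 2 ≤ w i j t then w i j t else 0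

/-- Two finite types with fixed-point-free involutions and equivariant labelings whose fibers have
equal cardinalities are isomorphic as labeled types with involution. -/
theorem exists_equiv_of_card_fiber_eq {α β κ : Type*} [Finite α] [Finite β]
    {σ : α → α} {τ : β → β} {ρ : κ → κ} {p : α → κ} {q : β → κ}
    (hσ : Function.Involutive σ) (hτ : Function.Involutive τ)
    (hσ' : ∀ a, σ a ≠ a) (hτ' : ∀ b, τ b ≠ b)
    (hp : ∀ a, p (σ a) = ρ (p a)) (hq : ∀ b, q (τ b) = ρ (q b))
    (hcard : ∀ k, Nat.card {a // p a = k} = Nat.card {b // q b = k}) :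
    ∃ e : α ≃ β, (∀ a, e (σ a) = τ (e a)) ∧ ∀ a, q (e a) = p a := by
  classical
  let Good : Set α → Prop := fun s => (∀ a ∈ s, σ a ∈ s) ∧ ∃ f : α → β, Set.InjOn f s ∧
    (∀ a ∈ s, f (σ a) = τ (f a)) ∧ ∀ a ∈ s, q (f a) = p a
  have hab : IsEmpty β → IsEmpty α := fun hβ => ⟨fun a => by
    have h := hcard (p a)
    have : Nonempty {x // p x = p a} := ⟨⟨a, rfl⟩⟩
    have h' : 0 < Nat.card {x // p x = p a} := Nat.card_pos
    simp [h] at h'⟩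
  have h0 : Good ∅ := by
    refine ⟨by simp, ?_⟩
    rcases isEmpty_or_nonempty β with h | ⟨⟨b⟩⟩
    · exact ⟨fun a => ((hab h).false a).elim, by simp⟩
    · exact ⟨fun _ => b, by simp⟩
  obtain ⟨s, hs⟩ := (Set.toFinite {s | Good s}).exists_maximal ⟨∅, h0⟩
  obtain ⟨⟨hcl, f, hinj, hcomm, hlab⟩, hmax⟩ := hs
  have hsuniv : ∀ a, a ∈ s := by
    intro a
    by_contra ha
    have hσa : σ a ∉ s := fun h => ha (by simpa [hσ a] using hcl _ h)
    have hb : ∃ b, q b = p a ∧ b ∉ f '' s := by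
      by_contra! hb
      have hsub : {b | q b = p a} ⊆ f '' (s ∩ {x | p x = p a}) := by
        intro b hb'
        obtain ⟨x, hx, rfl⟩ := hb b hb'
        exact ⟨x, ⟨hx, (hlab x hx).symm.trans hb'⟩, rfl⟩
      have h1 := (Set.ncard_le_ncard hsub (Set.toFinite _)).trans
        (Set.ncard_image_le (Set.toFinite _))
      have h2 : (s ∩ {x | p x = p a}).ncard < {x | p x = p a}.ncard :=
        Set.ncard_lt_ncard ⟨Set.inter_subset_right, fun h => ha (h rfl).1⟩ (Set.toFinite _)
      exact absurd (hcard (p a)) (h1.trans_lt h2).ne'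
    obtain ⟨b, hqb, hbs⟩ := hb
    have hτb : τ b ∉ f '' s := by
      rintro ⟨x, hx, hxb⟩
      exact hbs ⟨σ x, hcl x hx, by rw [hcomm x hx, hxb, hτ b]⟩
    have hne : ∀ x ∈ s, x ≠ a ∧ x ≠ σ a := fun x hx =>
      ⟨fun h => ha (h ▸ hx), fun h => hσa (h ▸ hx)⟩
    let f' : α → β := fun x => if x = a then b else if x = σ a then τ b else f x
    have fa : f' a = b := by simp [f']
    have fσa : f' (σ a) = τ b := by simp [f', hσ' a]
    have fs : ∀ x ∈ s, f' x = f x := fun x hx => by simp [f', hne x hx]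
    have hgood : Good (insert a (insert (σ a) s)) := by
      refine ⟨?_, f', ?_, ?_, ?_⟩
      · rintro x (rfl | rfl | hx)
        · simp
        · simp [hσ a]
        · exact Or.inr (Or.inr (hcl x hx))
      · have h1 : Set.InjOn f' s := fun x hx y hy h => hinj hx hy (by rwa [fs x hx, fs y hy] at h)
        have himg : f' '' s = f '' s := Set.image_congr fs
        rw [Set.injOn_insert (by simp [ha, (hσ' a).symm]), Set.injOn_insert hσa,
          Set.image_insert_eq, himg, fa, fσa]
        refine ⟨⟨h1, hτb⟩, ?_⟩
        rintro (h | h)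
        · exact hτ' b h.symm
        · exact hbs h
      · rintro x (rfl | rfl | hx)
        · rw [fa, fσa]
        · rw [hσ a, fa, fσa, hτ b]
        · rw [fs _ (hcl x hx), fs x hx, hcomm x hx]
      · rintro x (rfl | rfl | hx)
        · rw [fa, hqb]
        · rw [fσa, hq, hp, hqb]
        · rw [fs x hx, hlab x hx]
    exact ha (hmax hgood (fun x hx => Or.inr (Or.inr hx)) (Or.inl rfl))
  have hinj' : Function.Injective f := fun x y h => hinj (hsuniv x) (hsuniv y) h
  have hsurj : Function.Surjective f := by
    intro b
    let F : {a // p a = q b} → {b' // q b' = q b} := fun x => ⟨f x.1, (hlab _ (hsuniv _)).trans x.2⟩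
    have hF : Function.Injective F := fun x y h => Subtype.ext (hinj' (congrArg Subtype.val h))
    obtain ⟨x, hx⟩ := (hF.bijective_of_nat_card_le (hcard (q b)).ge).2 ⟨b, rfl⟩
    exact ⟨x.1, congrArg Subtype.val hx⟩
  exact ⟨Equiv.ofBijective f ⟨hinj', hsurj⟩, fun a => hcomm a (hsuniv a), fun a => hlab a (hsuniv a)⟩

/-- A finite type with a fixed-point-free involution has even cardinality. -/
theorem even_card_of_involutive {α : Type*} [Finite α] {σ : α → α}
    (hσ : Function.Involutive σ) (hσ' : ∀ a, σ a ≠ a) : Even (Nat.card α) := by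
  classical
  have := Fintype.ofFinite α
  have h : ∑ _a : α, (1 : ZMod 2) = 0 :=
    Finset.sum_involution (fun a _ => σ a) (fun _ _ => by decide) (fun a _ _ => hσ' a)
      (fun a _ => Finset.mem_univ _) (fun a _ => hσ a)
  rw [Nat.card_eq_fintype_card, ← ZMod.natCast_eq_zero_iff_even]
  simpa using h

/-- A potential half-edge, from `src` to `tgt` with timestamp `time`, belonging to the parallel
edge number `idx`; the field `side` tells apart the two halves of a loop. -/
@[ext]
structure HalfEdge (n T : ℕ) where
  src : Fin n
  tgt : Fin n
  time : Fin T
  idx : ℕ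
  side : Bool

namespace HalfEdge

variable {n T : ℕ}

/-- The opposite half of the same edge. -/
def rev (h : HalfEdge n T) : HalfEdge n T :=
  ⟨h.tgt, h.src, h.time, h.idx, if h.src = h.tgt then !h.side else h.side⟩

theorem rev_involutive : Function.Involutive (rev : HalfEdge n T → HalfEdge n T) := by
  rintro ⟨i, j, t, k, b⟩
  by_cases h : i = j
  · simp [rev, h]
  · simp [rev, h, Ne.symm h]

theorem rev_ne (h : HalfEdge n T) : h.rev ≠ h := by
  obtain ⟨i, j, t, k, b⟩ := h
  by_cases h : i = j
  · simp [rev, h]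
  · simp [rev, Ne.symm h]

end HalfEdge

section Counting

variable {n T : ℕ} {d : Fin n → ℕ} {g g' : Fin n → Fin n → Fin T → ℕ}

/-- The half-edges of the temporal multigraph with temporal multiplicities `g`. -/
def halfEdges (g : Fin n → Fin n → Fin T → ℕ) : Set (HalfEdge n T) :=
  {h | h.idx < g h.src h.tgt h.time ∧ (h.src ≠ h.tgt → h.side = false)}

theorem rev_mem_halfEdges (hsymm : ∀ i j t, g i j t = g j i t) {h : HalfEdge n T}
    (hh : h ∈ halfEdges g) : h.rev ∈ halfEdges g := by
  refine ⟨by simpa [HalfEdge.rev, hsymm h.tgt] using hh.1, fun hne => ?_⟩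
  have hne' : h.src ≠ h.tgt := Ne.symm hne
  simpa [HalfEdge.rev, hne'] using hh.2 hne'

/-- The involution on the half-edges of a multigraph. -/
def revOn (hsymm : ∀ i j t, g i j t = g j i t) (h : halfEdges g) : halfEdges g :=
  ⟨h.1.rev, rev_mem_halfEdges hsymm h.2⟩

theorem revOn_involutive (hsymm : ∀ i j t, g i j t = g j i t) :
    Function.Involutive (revOn hsymm) :=
  fun h => Subtype.ext (HalfEdge.rev_involutive h.1)

/-- The half-edges at a node, as non-loops and first halves of loops together with second halves
of loops. -/
def halfEdgesAtEquiv (g : Fin n → Fin n → Fin T → ℕ) (i : Fin n) :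
    {h : halfEdges g // h.1.src = i} ≃
      (Σ j, Σ t, Fin (g i j t)) ⊕ (Σ t, Fin (g i i t)) where
  toFun h := if hs : h.1.1.side = true
    then .inr ⟨h.1.1.time, h.1.1.idx, by
      have h1 := h.1.2.1
      have h2 : h.1.1.src = h.1.1.tgt := by
        by_contra hne
        simp [h.1.2.2 hne] at hs
      rwa [← h2, h.2] at h1⟩
    else .inl ⟨h.1.1.tgt, h.1.1.time, h.1.1.idx, by simpa only [h.2] using h.1.2.1⟩
  invFun := Sum.elim
    (fun x => ⟨⟨⟨i, x.1, x.2.1, x.2.2.1, false⟩, x.2.2.2, fun _ => rfl⟩, rfl⟩)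
    (fun x => ⟨⟨⟨i, i, x.1, x.2.1, true⟩, x.2.2, fun h => (h rfl).elim⟩, rfl⟩)
  left_inv := by
    rintro ⟨⟨⟨i', j, t, k, b⟩, h1, h2⟩, rfl⟩
    cases b
    · simp
    · have : i' = j := by
        by_contra hne
        simpa using h2 hne
      subst this
      simp
  right_inv := by
    rintro (x | x) <;> simp

theorem card_halfEdges_at (g : Fin n → Fin n → Fin T → ℕ) (i : Fin n) :
    Nat.card {h : halfEdges g // h.1.src = i} = tmDegree g i := by
  rw [Nat.card_congr (halfEdgesAtEquiv g i)]
  simp [tmDegree]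

theorem card_halfEdges_between (g : Fin n → Fin n → Fin T → ℕ) {i j : Fin n} (hij : i ≠ j)
    (t : Fin T) :
    Nat.card {h : halfEdges g // h.1.src = i ∧ h.1.tgt = j ∧ h.1.time = t} = g i j t := by
  rw [← Nat.card_fin (g i j t)]
  refine Nat.card_congr
    { toFun := fun h => ⟨h.1.1.idx, by
        have := h.1.2.1
        rwa [h.2.1, h.2.2.1, h.2.2.2] at this⟩
      invFun := fun k => ⟨⟨⟨i, j, t, k.1, false⟩, k.2, fun _ => rfl⟩, rfl, rfl, rfl⟩
      left_inv := ?_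
      right_inv := fun k => rfl }
  rintro ⟨⟨⟨i', j', t', k, b⟩, h1, h2⟩, rfl, rfl, rfl⟩
  obtain rfl : b = false := h2 hij
  rfl

theorem card_halfEdges_loop (g : Fin n → Fin n → Fin T → ℕ) (i : Fin n) (t : Fin T) :
    Nat.card {h : halfEdges g // h.1.src = i ∧ h.1.tgt = i ∧ h.1.time = t} = 2 * g i i t := by
  have : Nat.card (Bool × Fin (g i i t)) = 2 * g i i t := by simp
  rw [← this]
  refine Nat.card_congr
    { toFun := fun h => ⟨h.1.1.side, h.1.1.idx, by
        have := h.1.2.1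
        rwa [h.2.1, h.2.2.1, h.2.2.2] at this⟩
      invFun := fun k => ⟨⟨⟨i, i, t, k.2.1, k.1⟩, k.2.2, fun h => (h rfl).elim⟩, rfl, rfl, rfl⟩
      left_inv := ?_
      right_inv := fun k => rfl }
  rintro ⟨⟨⟨i', j', t', k, b⟩, h1, h2⟩, rfl, rfl', rfl⟩
  obtain rfl : j' = i' := rfl'
  rfl

/-- The configurations whose corresponding temporal multigraph is `g`. -/
abbrev ConfigsOf (d : Fin n → ℕ) (g : Fin n → Fin n → Fin T → ℕ) : Type :=
  {c : TConfig n d T // ∀ i j t, configGraph c i j t = g i j t}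

/-- The bijections from points to half-edges of `g` sending each cell to the half-edges at the
corresponding node. -/
abbrev Labeling (d : Fin n → ℕ) (g : Fin n → Fin n → Fin T → ℕ) : Type :=
  {φ : TPoint n d ≃ halfEdges g // ∀ x, (φ x).1.src = x.1}

/-- The half-edge permutations supported on `g` that preserve end nodes, timestamps, and edges. -/
def halfEdgeAut (g : Fin n → Fin n → Fin T → ℕ) : Set (Equiv.Perm (HalfEdge n T)) :=
  {f | (∀ h, h ∉ halfEdges g → f h = h) ∧ ∀ h, (f h).src = h.src ∧ (f h).time = h.time ∧
    f h.rev = (f h).rev}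

theorem nonempty_labeling (hdeg : ∀ i, tmDegree g i = d i) : Nonempty (Labeling d g) := by
  have e : ∀ i, Nonempty (Fin (d i) ≃ {h : halfEdges g // h.1.src = i}) := fun i => by
    have : Finite {h : halfEdges g // h.1.src = i} := Finite.of_equiv _ (halfEdgesAtEquiv g i).symm
    exact Finite.card_eq.1 (by simp [card_halfEdges_at, hdeg])
  refine ⟨(Equiv.sigmaCongrRight fun i => (e i).some).trans
    (Equiv.sigmaFiberEquiv fun h : halfEdges g => h.1.src), fun x => ?_⟩
  exact ((e x.1).some x.2).2

/-- The configuration in which points are matched when their labels form an edge. -/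
def Labeling.toConfig (hsymm : ∀ i j t, g i j t = g j i t) (φ : Labeling d g) :
    TConfig n d T where
  pair x := φ.1.symm (revOn hsymm (φ.1 x))
  stamp x := (φ.1 x).1.time
  invol x := by simp [revOn_involutive hsymm _]
  nofix x h := by
    have := congrArg φ.1 h
    rw [Equiv.apply_symm_apply] at this
    exact HalfEdge.rev_ne _ (congrArg Subtype.val this)
  compat x := by simp [revOn, HalfEdge.rev]

theorem Labeling.configGraph_toConfig (hsymm : ∀ i j t, g i j t = g j i t) (φ : Labeling d g)
    (i j : Fin n) (t : Fin T) : configGraph (φ.toConfig hsymm) i j t = g i j t := by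
  have key : ∀ j, Nat.card {x : TPoint n d // x.1 = i ∧ ((φ.toConfig hsymm).pair x).1 = j ∧
      (φ.toConfig hsymm).stamp x = t} =
      Nat.card {h : halfEdges g // h.1.src = i ∧ h.1.tgt = j ∧ h.1.time = t} := fun j =>
    Nat.card_congr (φ.1.subtypeEquiv fun x => by
      rw [← φ.2 x, ← φ.2 ((φ.toConfig hsymm).pair x)]
      simp [toConfig, revOn, HalfEdge.rev])
  unfold configGraph
  split_ifs with hij
  · subst hij
    rw [key, card_halfEdges_loop]
    omega
  · rw [key, card_halfEdges_between g hij]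

theorem Labeling.toConfig_eq_iff (hsymm : ∀ i j t, g i j t = g j i t) (φ : Labeling d g)
    (c : TConfig n d T) : φ.toConfig hsymm = c ↔
      ∀ x, (φ.1 (c.pair x)).1 = (φ.1 x).1.rev ∧ (φ.1 x).1.time = c.stamp x := by
  constructor
  · rintro rfl x
    simp [toConfig, revOn]
  · intro h
    obtain ⟨pair, stamp, _, _, _⟩ := c
    have h1 : (φ.toConfig hsymm).pair = pair := funext fun x =>
      (Equiv.symm_apply_eq _).2 (Subtype.ext (h x).1.symm)
    have h2 : (φ.toConfig hsymm).stamp = stamp := funext fun x => (h x).2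
    subst h1 h2
    rfl

theorem card_config_between (c : ConfigsOf d g) {i j : Fin n} (hij : i ≠ j) (t : Fin T) :
    Nat.card {x : TPoint n d // x.1 = i ∧ (c.1.pair x).1 = j ∧ c.1.stamp x = t} = g i j t := by
  rw [← c.2 i j t, configGraph, if_neg hij]

theorem card_config_loop (c : ConfigsOf d g) (i : Fin n) (t : Fin T) :
    Nat.card {x : TPoint n d // x.1 = i ∧ (c.1.pair x).1 = i ∧ c.1.stamp x = t} =
      2 * g i i t := by
  have h := c.2 i i t
  rw [configGraph, if_pos rfl] at h
  have := even_card_of_involutive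
    (α := {x : TPoint n d // x.1 = i ∧ (c.1.pair x).1 = i ∧ c.1.stamp x = t})
    (σ := fun x => ⟨c.1.pair x.1, x.2.2.1, by rw [c.1.invol, x.2.1],
      by rw [c.1.compat, x.2.2.2]⟩)
    (fun x => Subtype.ext (c.1.invol x.1)) (fun x h => c.1.nofix x.1 (congrArg Subtype.val h))
  rw [← h, Nat.two_mul_div_two_of_even this]

theorem exists_labeling_toConfig_eq (hsymm : ∀ i j t, g i j t = g j i t)
    (hdeg : ∀ i, tmDegree g i = d i) (c : ConfigsOf d g) :
    ∃ φ : Labeling d g, φ.toConfig hsymm = c.1 := by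
  have : Finite (halfEdges g) := Finite.of_equiv _ (nonempty_labeling hdeg).some.1
  obtain ⟨e, he, hk⟩ := exists_equiv_of_card_fiber_eq
    (σ := c.1.pair) (τ := revOn hsymm)
    (ρ := fun k : Fin n × Fin n × Fin T => (k.2.1, k.1, k.2.2))
    (p := fun x => (x.1, (c.1.pair x).1, c.1.stamp x))
    (q := fun h => (h.1.src, h.1.tgt, h.1.time))
    c.1.invol (revOn_involutive hsymm) c.1.nofix
    (fun h hh => HalfEdge.rev_ne _ (congrArg Subtype.val hh))
    (fun x => by simp [c.1.invol x, c.1.compat x]) (fun h => rfl)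
    (by
      rintro ⟨i, j, t⟩
      simp only [Prod.mk.injEq]
      by_cases hij : i = j
      · subst hij
        rw [card_config_loop, card_halfEdges_loop]
      · rw [card_config_between c hij, card_halfEdges_between g hij])
  simp only [Prod.mk.injEq] at hk
  refine ⟨⟨e, fun x => (hk x).1⟩, (Labeling.toConfig_eq_iff hsymm _ _).2 fun x => ⟨?_, (hk x).2.2⟩⟩
  rw [he]
  rfl

theorem apply_mem_halfEdges_iff {f : Equiv.Perm (HalfEdge n T)} (hf : f ∈ halfEdgeAut g)
    (h : HalfEdge n T) : f h ∈ halfEdges g ↔ h ∈ halfEdges g := by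
  constructor
  · intro h1
    by_contra h2
    exact h2 (hf.1 h h2 ▸ h1)
  · intro h1
    by_contra h2
    exact h2 ((f.injective (hf.1 _ h2)).symm ▸ h1)

open Classical in
/-- The labelings inducing a given configuration form a torsor under the automorphisms of the
half-edges. -/
noncomputable def labelingFiberEquiv (hsymm : ∀ i j t, g i j t = g j i t) {c : TConfig n d T}
    (φ₀ : Labeling d g) (hφ₀ : φ₀.toConfig hsymm = c) :
    {φ : Labeling d g // φ.toConfig hsymm = c} ≃ halfEdgeAut g where
  toFun φ := ⟨Equiv.Perm.ofSubtype (φ₀.1.symm.trans φ.1.1),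
    fun h hh => Equiv.Perm.ofSubtype_apply_of_not_mem _ hh, fun h => by
      have h₀ := (Labeling.toConfig_eq_iff hsymm _ _).1 hφ₀
      have h₁ := (Labeling.toConfig_eq_iff hsymm _ _).1 φ.2
      by_cases hh : h ∈ halfEdges g
      · obtain ⟨x, hx⟩ := φ₀.1.surjective ⟨h, hh⟩
        obtain rfl : (φ₀.1 x).1 = h := congrArg Subtype.val hx
        rw [← (h₀ x).1]
        simp only [Equiv.Perm.ofSubtype_apply_coe, Equiv.trans_apply, Equiv.symm_apply_apply]
        exact ⟨(φ.1.2 x).trans (φ₀.2 x).symm, (h₁ x).2.trans (h₀ x).2.symm, (h₁ x).1⟩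
      · have hr : h.rev ∉ halfEdges g := fun hr => hh (by
          simpa [HalfEdge.rev_involutive h] using rev_mem_halfEdges hsymm hr)
        rw [Equiv.Perm.ofSubtype_apply_of_not_mem _ hh, Equiv.Perm.ofSubtype_apply_of_not_mem _ hr]
        simp⟩
  invFun f := ⟨⟨φ₀.1.trans (f.1.subtypePerm (apply_mem_halfEdges_iff f.2)), fun x =>
      (f.2.2 _).1.trans (φ₀.2 x)⟩, by
    have h₀ := (Labeling.toConfig_eq_iff hsymm _ _).1 hφ₀
    refine (Labeling.toConfig_eq_iff hsymm _ _).2 fun x => ⟨?_, ?_⟩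
    · simp [(h₀ x).1, (f.2.2 _).2.2]
    · exact (f.2.2 _).2.1.trans (h₀ x).2⟩
  left_inv φ := by
    refine Subtype.ext (Subtype.ext (Equiv.ext fun x => Subtype.ext ?_))
    simp
  right_inv f := by
    refine Subtype.ext (Equiv.ext fun h => ?_)
    by_cases hh : h ∈ halfEdges g
    · have := Equiv.Perm.ofSubtype_apply_of_mem
        (φ₀.1.symm.trans (φ₀.1.trans (f.1.subtypePerm (apply_mem_halfEdges_iff f.2)))) hh
      simpa using this
    · exact (Equiv.Perm.ofSubtype_apply_of_not_mem _ hh).trans (f.2.1 h hh).symm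

theorem card_labeling (hsymm : ∀ i j t, g i j t = g j i t) (hdeg : ∀ i, tmDegree g i = d i) :
    Nat.card (Labeling d g) = Nat.card (ConfigsOf d g) * Nat.card (halfEdgeAut g) := by
  let F : Labeling d g → ConfigsOf d g := fun φ =>
    ⟨φ.toConfig hsymm, φ.configGraph_toConfig hsymm⟩
  have e : ∀ c : ConfigsOf d g, Nonempty ({φ // F φ = c} ≃ halfEdgeAut g) := fun c => by
    obtain ⟨φ₀, h₀⟩ := exists_labeling_toConfig_eq hsymm hdeg c
    exact ⟨(Equiv.subtypeEquivRight fun φ => Subtype.ext_iff).trans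
      (labelingFiberEquiv hsymm φ₀ h₀)⟩
  rw [← Nat.card_prod]
  exact Nat.card_congr ((Equiv.sigmaFiberEquiv F).symm.trans
    ((Equiv.sigmaCongrRight fun c => (e c).some).trans (Equiv.sigmaEquivProd _ _)))

theorem card_labeling_ne_zero (hdeg : ∀ i, tmDegree g i = d i) :
    Nat.card (Labeling d g) ≠ 0 := by
  have := nonempty_labeling hdeg
  have : Finite (halfEdges g) := Finite.of_equiv _ this.some.1
  exact Nat.card_pos.ne'

theorem card_labeling_eq (hdeg : ∀ i, tmDegree g i = d i) (hdeg' : ∀ i, tmDegree g' i = d i) :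
    Nat.card (Labeling d g) = Nat.card (Labeling d g') := by
  obtain ⟨φ⟩ := nonempty_labeling hdeg
  obtain ⟨φ'⟩ := nonempty_labeling hdeg'
  have h : ∀ y, (φ'.1 (φ.1.symm y)).1.src = y.1.src := fun y => by
    rw [φ'.2, ← φ.2, Equiv.apply_symm_apply]
  refine Nat.card_congr ((Equiv.equivCongr (Equiv.refl _) (φ.1.symm.trans φ'.1)).subtypeEquiv
    fun ψ => forall_congr' fun x => ?_)
  simp [h]

/-- Simple edges do not contribute to the automorphisms. -/
theorem halfEdgeAut_Wtensor (g : Fin n → Fin n → Fin T → ℕ) :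
    halfEdgeAut (Wtensor g) = halfEdgeAut g := by
  have hsub : halfEdges (Wtensor g) ⊆ halfEdges g := by
    rintro ⟨i, j, t, k, b⟩ ⟨h1, h2⟩
    refine ⟨?_, h2⟩
    simp only [Wtensor] at h1 ⊢
    split_ifs at h1 with h h'
    · exact h ▸ h1
    · exact h1
    · omega
  ext f
  refine ⟨fun hf => ⟨fun h hh => hf.1 h fun h' => hh (hsub h'), hf.2⟩,
    fun hf => ⟨fun h hh => ?_, hf.2⟩⟩
  by_cases hg : h ∈ halfEdges g
  · have hfg := (apply_mem_halfEdges_iff hf h).2 hg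
    obtain ⟨hs, ht, hr⟩ := hf.2 h
    have htgt : (f h).tgt = h.tgt := by
      rw [show (f h).tgt = (f h).rev.src from rfl, ← hr, (hf.2 h.rev).1]
      rfl
    have hne : h.src ≠ h.tgt := fun heq => hh ⟨by
      have := hg.1
      rw [← heq] at this
      simpa [Wtensor, ← heq] using this, fun hne => (hne heq).elim⟩
    have hlt : g h.src h.tgt h.time < 2 := by
      by_contra! hge
      exact hh ⟨by simpa [Wtensor, hne, hge] using hg.1, hg.2⟩
    have h1 := hg.1
    have h2 := hfg.1
    rw [hs, ht, htgt] at h2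
    refine HalfEdge.ext hs htgt ht (by omega) ?_
    rw [hg.2 hne, hfg.2 (by rwa [hs, htgt])]
  · exact hf.1 h hg

theorem card_configsOf_eq (hsymm : ∀ i j t, g i j t = g j i t)
    (hsymm' : ∀ i j t, g' i j t = g' j i t)
    (hdeg : ∀ i, tmDegree g i = d i) (hdeg' : ∀ i, tmDegree g' i = d i)
    (hW : Wtensor g = Wtensor g') :
    Nat.card (ConfigsOf d g) = Nat.card (ConfigsOf d g') := by
  have hAut : halfEdgeAut g = halfEdgeAut g' := by
    rw [← halfEdgeAut_Wtensor g, hW, halfEdgeAut_Wtensor g']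
  have hL := card_labeling hsymm hdeg
  have h0 := card_labeling_ne_zero hdeg
  rw [hL] at h0
  rw [card_labeling_eq hdeg hdeg', card_labeling hsymm' hdeg', hAut] at hL
  rw [hAut] at h0
  exact (Nat.eq_of_mul_eq_mul_right (Nat.pos_of_ne_zero (right_ne_zero_of_mul h0)) hL).symm

end Counting

/-- If two temporal multigraphs `g, g'` matching `(d, T)` have the same tensor `W`, then the
same number of temporal configurations corresponds to each; consequently, the temporal
multigraph of a uniformly random temporal configuration is uniformly distributed on each
set `S(W)`: the probabilities of producing `g` and `g'` coincide. -/
theorem stmt3 (n T : ℕ) (d : Fin n → ℕ) (M : ℕ) (hM : M = ∑ i, d i)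
    (hEven : Even M) (hT : 1 ≤ T)
    (g g' : Fin n → Fin n → Fin T → ℕ)
    (hsymm : ∀ i j t, g i j t = g j i t) (hsymm' : ∀ i j t, g' i j t = g' j i t)
    (hdeg : ∀ i, tmDegree g i = d i) (hdeg' : ∀ i, tmDegree g' i = d i)
    (hW : ∀ i j t, Wtensor g i j t = Wtensor g' i j t) :
    Nat.card {c : TConfig n d T // ∀ i j t, configGraph c i j t = g i j t} =
      Nat.card {c : TConfig n d T // ∀ i j t, configGraph c i j t = g' i j t} ∧
    (Nat.card {c : TConfig n d T // ∀ i j t, configGraph c i j t = g i j t} : ℝ) /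
        Nat.card (TConfig n d T) =
      (Nat.card {c : TConfig n d T // ∀ i j t, configGraph c i j t = g' i j t} : ℝ) /
        Nat.card (TConfig n d T) := by
  have h := card_configsOf_eq hsymm hsymm' hdeg hdeg'
    (funext fun i => funext fun j => funext fun t => hW i j t)
  exact ⟨h, by rw [h]⟩
end

section
/- Let D = (d, T) with d = (d_1, …, d_n), M = Σ_i d_i even and M ≥ 4, and T ≥ 1, and sample a temporal configuration of D uniformly at random. Then the expected number of unordered pairs {e, e'} of distinct matched pairs such that, for some i ≠ j, both e and e' consist of one point of cell P_i and one point of cell P_j and e and e' are assigned the same timestamp (i.e., the expected number of temporal double-edges between distinct nodes) is at most M_2^2 / (T (M − 1)(M − 3)), where M_2 = Σ_i d_i(d_i − 1). -/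
open Finset

namespace TConfig

variable {n T : ℕ} {d : Fin n → ℕ}

theorem ext_fields {C D : TConfig n d T} (h : C.pair = D.pair) (h' : C.stamp = D.stamp) :
    C = D := by
  cases C; cases D; simp_all

instance instFinite : Finite (TConfig n d T) :=
  Finite.of_injective
    (fun C => ((C.pair, C.stamp) : (TPoint n d → TPoint n d) × (TPoint n d → Fin T)))
    fun _ _ h => ext_fields (congrArg Prod.fst h) (congrArg Prod.snd h)

/-- Relabel the points of a temporal configuration along a permutation. -/
def relabel (σ : Equiv.Perm (TPoint n d)) (C : TConfig n d T) : TConfig n d T where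
  pair z := σ (C.pair (σ.symm z))
  stamp z := C.stamp (σ.symm z)
  invol z := by simp [C.invol (σ.symm z)]
  nofix _ h := C.nofix _ (σ.eq_symm_apply.2 h)
  compat z := by simp [C.compat]

/-- Replace the timestamp of the pair containing `y` by `t`. -/
def restamp (y : TPoint n d) (t : Fin T) (C : TConfig n d T) : TConfig n d T where
  pair := C.pair
  stamp z := if z = y ∨ z = C.pair y then t else C.stamp z
  invol := C.invol
  nofix := C.nofix
  compat z := by
    have h₁ : C.pair z = y ↔ z = C.pair y := C.invol.eq_iff
    have h₂ : C.pair z = C.pair y ↔ z = y := C.invol.injective.eq_iff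
    simp only [h₁, h₂, C.compat, or_comm]

end TConfig

theorem exists_perm_fixing_two {α : Type*} [DecidableEq α] {x x' y y' a b : α}
    (hx : x' ≠ x) (hxy : x' ≠ y) (hyx : y' ≠ x) (hy : y' ≠ y) (hne : y' ≠ x')
    (hax : a ≠ x) (hay : a ≠ y) (hbx : b ≠ x) (hby : b ≠ y) (hba : b ≠ a) :
    ∃ σ : Equiv.Perm α, σ x = x ∧ σ y = y ∧ σ x' = a ∧ σ y' = b := by
  refine ⟨Equiv.swap (Equiv.swap x' a y') b * Equiv.swap x' a, ?_, ?_, ?_, ?_⟩ <;>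
  · simp only [Equiv.Perm.mul_apply, Equiv.swap_apply_def]
    grind

theorem card_pairs_avoiding {α : Type*} [Fintype α] {x y : α} (h : x ≠ y) :
    Nat.card {p : α × α // p.1 ≠ x ∧ p.1 ≠ y ∧ p.2 ≠ x ∧ p.2 ≠ y ∧ p.2 ≠ p.1} =
      (Fintype.card α - 2) * (Fintype.card α - 3) := by
  classical
  have key : (univ.filter fun p : α × α =>
      p.1 ≠ x ∧ p.1 ≠ y ∧ p.2 ≠ x ∧ p.2 ≠ y ∧ p.2 ≠ p.1) =
      (({x, y} : Finset α)ᶜ).offDiag := by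
    ext p
    simp only [mem_filter, mem_univ, true_and, mem_offDiag, mem_compl, mem_insert,
      mem_singleton]
    grind
  rw [Nat.card_eq_fintype_card, Fintype.card_subtype, key, offDiag_card, card_compl,
    card_pair h, ← Nat.mul_sub_one, Nat.sub_sub]

/-- The temporal configurations containing two prescribed pairs with equal timestamps. -/
abbrev DoubleAt (n : ℕ) (d : Fin n → ℕ) (T : ℕ) (x x' y y' : TPoint n d) : Type :=
  {C : TConfig n d T // C.pair x = x' ∧ C.pair y = y' ∧ C.stamp y = C.stamp x}

theorem card_doubleAt_mul_le {n T : ℕ} {d : Fin n → ℕ} {x x' y y' : TPoint n d}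
    (hyx : y ≠ x) (hyx' : y ≠ x') :
    Nat.card (DoubleAt n d T x x' y y') * ((∑ i, d i - 2) * (∑ i, d i - 3) * T) ≤
      Nat.card (TConfig n d T) := by
  classical
  rcases isEmpty_or_nonempty (DoubleAt n d T x x' y y') with h | ⟨⟨C₀, hx, hy, -⟩⟩
  · simp
  have hxx' : x' ≠ x := hx ▸ C₀.nofix x
  have hyy' : y' ≠ y := hy ▸ C₀.nofix y
  have hy'x : y' ≠ x := fun h => hyx' (by rw [← hx, ← h, ← hy, C₀.invol y])
  have hy'x' : y' ≠ x' := fun h => hyx (C₀.invol.injective (by rw [hx, hy, h]))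
  let Q := {p : TPoint n d × TPoint n d //
    p.1 ≠ x ∧ p.1 ≠ y ∧ p.2 ≠ x ∧ p.2 ≠ y ∧ p.2 ≠ p.1}
  have hσ (q : Q) : ∃ σ : Equiv.Perm (TPoint n d),
      σ x = x ∧ σ y = y ∧ σ x' = q.1.1 ∧ σ y' = q.1.2 :=
    exists_perm_fixing_two hxx' hyx'.symm hy'x hyy' hy'x' q.2.1 q.2.2.1 q.2.2.2.1
      q.2.2.2.2.1 q.2.2.2.2.2
  choose σ hσx hσy hσx' hσy' using hσ
  have hsx (q : Q) : (σ q).symm x = x := (Equiv.symm_apply_eq _).2 (hσx q).symm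
  have hsy (q : Q) : (σ q).symm y = y := (Equiv.symm_apply_eq _).2 (hσy q).symm
  let F : DoubleAt n d T x x' y y' × Q × Fin T → TConfig n d T := fun p =>
    (p.1.1.relabel (σ p.2.1)).restamp y p.2.2
  have hFx (p) : (F p).pair x = p.2.1.1.1 := by
    simp only [F, TConfig.restamp, TConfig.relabel, hsx, p.1.2.1, hσx']
  have hFy (p) : (F p).pair y = p.2.1.1.2 := by
    simp only [F, TConfig.restamp, TConfig.relabel, hsy, p.1.2.2.1, hσy']
  have hFt (p) : (F p).stamp y = p.2.2 := by
    simp [F, TConfig.restamp]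
  have hFs (p) (z) : p.1.1.stamp z =
      if z = y ∨ z = y' then (F p).stamp x else (F p).stamp (σ p.2.1 z) := by
    have hstamp (z) : (F p).stamp (σ p.2.1 z) =
        if z = y ∨ z = y' then p.2.2 else p.1.1.stamp z := by
      have h₁ : σ p.2.1 z = y ↔ z = y := by
        rw [← (σ p.2.1).apply_eq_iff_eq (x := z), hσy]
      have h₂ : σ p.2.1 z = p.2.1.1.2 ↔ z = y' := by
        rw [← (σ p.2.1).apply_eq_iff_eq (x := z), hσy']
      simp only [F, TConfig.restamp, TConfig.relabel, hsy, p.1.2.2.1, hσy', h₁, h₂,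
        Equiv.symm_apply_apply]
    have hx := hstamp x
    rw [hσx, if_neg (by simp [hyx.symm, hy'x.symm])] at hx
    rw [hx, hstamp]
    split_ifs with hz
    · rcases hz with rfl | rfl
      · exact p.1.2.2.2
      · rw [← p.1.2.2.2, ← p.1.1.compat y, p.1.2.2.1]
    · rfl
  have hFp (p) (z) : p.1.1.pair z = (σ p.2.1).symm ((F p).pair (σ p.2.1 z)) := by
    simp [F, TConfig.restamp, TConfig.relabel]
  have hF : Function.Injective F := by
    intro p q h
    have h₁ : p.2.1 = q.2.1 :=
      Subtype.ext (Prod.ext (by rw [← hFx, ← hFx, h]) (by rw [← hFy, ← hFy, h]))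
    have h₂ : p.2.2 = q.2.2 := by rw [← hFt, ← hFt, h]
    have h₃ : p.1 = q.1 := Subtype.ext <| TConfig.ext_fields
      (funext fun z => by rw [hFp, hFp, h, h₁]) (funext fun z => by rw [hFs, hFs, h, h₁])
    exact Prod.ext h₃ (Prod.ext h₁ h₂)
  have hcard := Nat.card_le_card_of_injective F hF
  rw [Nat.card_prod, Nat.card_prod, card_pairs_avoiding hyx.symm] at hcard
  simpa using hcard

/-- Ordered pairs of distinct points in a common cell. -/
abbrev cellPairs (n : ℕ) (d : Fin n → ℕ) : Finset (TPoint n d × TPoint n d) :=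
  univ.filter fun p => p.1.1 = p.2.1 ∧ p.1 ≠ p.2

theorem card_cellPairs (n : ℕ) (d : Fin n → ℕ) :
    (#(cellPairs n d) : ℝ) = ∑ i, (d i : ℝ) * ((d i : ℝ) - 1) := by
  have h : cellPairs n d = univ.biUnion fun i =>
      (univ : Finset (Fin (d i))).offDiag.map
        ((Function.Embedding.sigmaMk i).prodMap (Function.Embedding.sigmaMk i)) := by
    ext ⟨⟨i, a⟩, ⟨j, b⟩⟩
    simp only [mem_filter, mem_univ, true_and, mem_biUnion, mem_map, mem_offDiag,
      Prod.exists]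
    constructor
    · rintro ⟨h, hne⟩
      obtain rfl : i = j := h
      exact ⟨i, a, b, fun h => hne (by rw [h]), rfl⟩
    · rintro ⟨k, a', b', hne, h⟩
      simp only [Function.Embedding.coe_prodMap, Prod.map_apply,
        Function.Embedding.sigmaMk_apply, Prod.mk.injEq] at h
      obtain ⟨h₁, h₂⟩ := h
      cases h₁
      cases h₂
      simpa using hne
  rw [h, card_biUnion]
  · push_cast
    refine sum_congr rfl fun i _ => ?_
    rw [card_map, offDiag_card, card_univ, Fintype.card_fin,
      Nat.cast_sub (Nat.le_mul_self _)]
    push_cast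
    ring
  · intro i _ j _ hij
    rw [Function.onFun, disjoint_left]
    simp only [mem_map, mem_offDiag, Prod.exists, not_exists, not_and]
    rintro _ ⟨a, b, -, rfl⟩ a' b' - h
    exact hij (congrArg (fun p : TPoint n d × TPoint n d => p.1.1) h).symm

/-- Quadruples `(x, x', y, y')` of points for which the pairs `{x, x'}` and `{y, y'}` are
disjoint and join the same two cells. -/
abbrev parallelQuads (n : ℕ) (d : Fin n → ℕ) :
    Finset ((TPoint n d × TPoint n d) × TPoint n d × TPoint n d) :=
  univ.filter fun q => q.2.1 ≠ q.1.1 ∧ q.2.1 ≠ q.1.2 ∧ q.2.2 ≠ q.1.1 ∧ q.2.2 ≠ q.1.2 ∧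
    ((q.2.1.1 = q.1.1.1 ∧ q.2.2.1 = q.1.2.1) ∨ (q.2.1.1 = q.1.2.1 ∧ q.2.2.1 = q.1.1.1))

theorem card_parallelQuads_le (n : ℕ) (d : Fin n → ℕ) :
    #(parallelQuads n d) ≤ 2 * #(cellPairs n d) ^ 2 := by
  classical
  let W := cellPairs n d ×ˢ cellPairs n d
  have hsub : parallelQuads n d ⊆
      W.image (fun w => ((w.1.1, w.2.1), (w.1.2, w.2.2))) ∪
      W.image (fun w => ((w.1.1, w.2.1), (w.2.2, w.1.2))) := by
    rintro ⟨⟨x, x'⟩, ⟨y, y'⟩⟩ h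
    simp only [mem_filter, mem_univ, true_and] at h
    obtain ⟨h₁, h₂, h₃, h₄, h | h⟩ := h
    · exact mem_union_left _ (mem_image.2 ⟨((x, y), (x', y')),
        by simp [W, h.1, h.2, h₁.symm, h₄.symm], rfl⟩)
    · exact mem_union_right _ (mem_image.2 ⟨((x, y'), (x', y)),
        by simp [W, h.1, h.2, h₂.symm, h₃.symm], rfl⟩)
  calc #(parallelQuads n d) ≤ _ := card_le_card hsub
    _ ≤ _ := card_union_le _ _
    _ ≤ #W + #W := add_le_add card_image_le card_image_le
    _ = 2 * #(cellPairs n d) ^ 2 := by rw [card_product]; ring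

/-- The expected number of temporal double-edges between distinct nodes (unordered pairs
`{e, e'}` of distinct matched pairs with, for some `i ≠ j`, one point of each in cell `i`
and one in cell `j`, and the same timestamp) of a uniformly random temporal configuration
is at most `M₂² / (T (M-1)(M-3))`.  Each such unordered pair `{e, e'}` is witnessed by
exactly `8` triples (configuration, x, y) below, whence the division by `8`. -/
theorem stmt5 (n T : ℕ) (d : Fin n → ℕ) (M : ℕ) (hM : M = ∑ i, d i)
    (hEven : Even M) (hM4 : 4 ≤ M) (hT : 1 ≤ T) :
    (Nat.card {p : TConfig n d T × TPoint n d × TPoint n d //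
        (p.2.1).1 ≠ (p.1.pair p.2.1).1 ∧
        p.2.2 ≠ p.2.1 ∧ p.2.2 ≠ p.1.pair p.2.1 ∧
        (((p.2.2).1 = (p.2.1).1 ∧ (p.1.pair p.2.2).1 = (p.1.pair p.2.1).1) ∨
          ((p.2.2).1 = (p.1.pair p.2.1).1 ∧ (p.1.pair p.2.2).1 = (p.2.1).1)) ∧
        p.1.stamp p.2.2 = p.1.stamp p.2.1} : ℝ) /
      (8 * Nat.card (TConfig n d T)) ≤
    (∑ i, (d i : ℝ) * ((d i : ℝ) - 1)) ^ 2 /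
      ((T : ℝ) * ((M : ℝ) - 1) * ((M : ℝ) - 3)) := by
  classical
  let A := {p : TConfig n d T × TPoint n d × TPoint n d //
        (p.2.1).1 ≠ (p.1.pair p.2.1).1 ∧
        p.2.2 ≠ p.2.1 ∧ p.2.2 ≠ p.1.pair p.2.1 ∧
        (((p.2.2).1 = (p.2.1).1 ∧ (p.1.pair p.2.2).1 = (p.1.pair p.2.1).1) ∨
          ((p.2.2).1 = (p.1.pair p.2.1).1 ∧ (p.1.pair p.2.2).1 = (p.2.1).1)) ∧
        p.1.stamp p.2.2 = p.1.stamp p.2.1}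
  let f : A → Σ q : parallelQuads n d, DoubleAt n d T q.1.1.1 q.1.1.2 q.1.2.1 q.1.2.2 :=
    fun p => ⟨⟨((p.1.2.1, p.1.1.pair p.1.2.1), (p.1.2.2, p.1.1.pair p.1.2.2)), by
        obtain ⟨⟨C, x, y⟩, -, h₁, h₂, h₃, -⟩ := p
        simp only [mem_filter, mem_univ, true_and]
        exact ⟨h₁, h₂, fun h => h₂ (C.invol.eq_iff.1 h),
          fun h => h₁ (C.invol.injective h), h₃⟩⟩,
      ⟨p.1.1, rfl, rfl, p.2.2.2.2.2⟩⟩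
  have hf : Function.Injective f := by
    rintro ⟨⟨C, x, y⟩, hp⟩ ⟨⟨D, u, v⟩, hq⟩ h
    have hx : x = u := congrArg (fun s => s.1.1.1.1) h
    have hy : y = v := congrArg (fun s => s.1.1.2.1) h
    have hC : C = D := congrArg (fun s => s.2.1) h
    subst hx hy hC
    rfl
  have hA := Nat.card_le_card_of_injective f hf
  rw [Nat.card_sigma] at hA
  set N := Nat.card (TConfig n d T)
  have hbound : Nat.card A * ((M - 2) * (M - 3) * T) ≤ 2 * #(cellPairs n d) ^ 2 * N :=
    calc Nat.card A * ((M - 2) * (M - 3) * T)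
        ≤ (∑ q : parallelQuads n d, Nat.card
            (DoubleAt n d T q.1.1.1 q.1.1.2 q.1.2.1 q.1.2.2)) * ((M - 2) * (M - 3) * T) :=
          Nat.mul_le_mul_right _ hA
      _ ≤ ∑ _q : parallelQuads n d, N := by
          rw [sum_mul]
          refine sum_le_sum fun q _ => ?_
          have hq := (mem_filter.1 q.2).2
          rw [hM]
          exact card_doubleAt_mul_le hq.1 hq.2.1
      _ = #(parallelQuads n d) * N := by simp
      _ ≤ _ := Nat.mul_le_mul_right _ (card_parallelQuads_le n d)
  rw [← card_cellPairs]
  have hMr : (4 : ℝ) ≤ M := by exact_mod_cast hM4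
  have hTr : (1 : ℝ) ≤ T := by exact_mod_cast hT
  have hb : (Nat.card A : ℝ) * (((M : ℝ) - 2) * ((M : ℝ) - 3) * T) ≤
      2 * (#(cellPairs n d) : ℝ) ^ 2 * N := by
    have := (Nat.cast_le (α := ℝ)).2 hbound
    rwa [Nat.cast_mul, Nat.cast_mul, Nat.cast_mul, Nat.cast_sub (by omega),
      Nat.cast_sub (by omega), Nat.cast_mul, Nat.cast_mul, Nat.cast_pow] at this
  have hM3 : (0 : ℝ) < (M : ℝ) - 3 := by linarith
  have hden : (0 : ℝ) < (T : ℝ) * ((M : ℝ) - 1) * ((M : ℝ) - 3) :=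
    mul_pos (mul_pos (by linarith) (by linarith)) hM3
  change (Nat.card A : ℝ) / (8 * N) ≤ _
  rcases N.eq_zero_or_pos with hN | hN
  · rw [hN, Nat.cast_zero, mul_zero, div_zero]
    positivity
  have hNr : (0 : ℝ) < N := by exact_mod_cast hN
  rw [div_le_div_iff₀ (by positivity) hden]
  calc (Nat.card A : ℝ) * ((T : ℝ) * ((M : ℝ) - 1) * ((M : ℝ) - 3))
      ≤ (Nat.card A : ℝ) * ((T : ℝ) * (2 * ((M : ℝ) - 2)) * ((M : ℝ) - 3)) := by
        gcongr
        linarith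
    _ = 2 * ((Nat.card A : ℝ) * (((M : ℝ) - 2) * ((M : ℝ) - 3) * T)) := by ring
    _ ≤ 2 * (2 * (#(cellPairs n d) : ℝ) ^ 2 * N) := by gcongr
    _ ≤ (#(cellPairs n d) : ℝ) ^ 2 * (8 * N) := by
        have : 0 ≤ (#(cellPairs n d) : ℝ) ^ 2 * N := by positivity
        linarith
end

section
/- Let D = (d, T) with d = (d_1, …, d_n), M = Σ_i d_i even, T ≥ 1, let m ≥ 1 with 2m ≤ M, and sample a temporal configuration of D uniformly at random. Then the expected number of indices i such that at least m matched pairs have both points in the cell P_i (i.e., the expected number of nodes incident with at least m loops) is at most M_{2m} / (2^m · m! · ∏_{k=0}^{m-1} (M − 2k − 1)), where M_{2m} = Σ_i d_i(d_i − 1)⋯(d_i − 2m + 1). -/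
namespace TConfig

variable {n : ℕ} {d : Fin n → ℕ} {T : ℕ}

instance : Finite (TConfig n d T) :=
  Finite.of_injective (fun c : TConfig n d T => (c.pair, c.stamp)) fun a b h => by
    cases a; cases b; simpa using h

/-- The configuration obtained by relabeling the points of `c` along the permutation `σ`. -/
def conj (σ : Equiv.Perm (TPoint n d)) (c : TConfig n d T) : TConfig n d T where
  pair x := σ (c.pair (σ.symm x))
  stamp x := c.stamp (σ.symm x)
  invol x := by simp [c.invol (σ.symm x)]
  nofix x h := c.nofix (σ.symm x) (by simpa using congrArg σ.symm h)
  compat x := by simp [c.compat]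

theorem conj_swap_conj_swap (y z : TPoint n d) (c : TConfig n d T) :
    conj (Equiv.swap y z) (conj (Equiv.swap y z) c) = c := by
  cases c; simp [conj]

open Classical in
/-- The points of `A` whose partner in `c` also lies in `A`. -/
noncomputable def loopPoints (c : TConfig n d T) (A : Finset (TPoint n d)) :
    Finset (TPoint n d) := {x ∈ A | c.pair x ∈ A}

open Classical in
theorem card_loopPoints_le_card_offDiag (c : TConfig n d T) (A : Finset (TPoint n d)) :
    (c.loopPoints A).card ≤ (A.offDiag.filter fun p => c.pair p.1 = p.2).card := by
  refine Finset.card_le_card_of_injOn (fun x => (x, c.pair x)) ?_ ?_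
  · intro x hx
    simp only [loopPoints, Finset.coe_filter, Set.mem_ofPred_eq] at hx
    simp [hx.1, hx.2, (c.nofix x).symm]
  · intro x _ y _ h
    exact congrArg Prod.fst h

open Classical in
theorem card_loopPoints_le_sdiff (c : TConfig n d T) (A : Finset (TPoint n d))
    {x y : TPoint n d} (h : c.pair x = y) :
    (c.loopPoints A).card ≤ (c.loopPoints (A \ {x, y})).card + 2 := by
  have hy : c.pair y = x := h ▸ c.invol x
  calc (c.loopPoints A).card ≤ (c.loopPoints (A \ {x, y}) ∪ {x, y}).card := by
        refine Finset.card_le_card fun z hz => ?_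
        simp only [loopPoints, Finset.mem_filter, Finset.mem_union, Finset.mem_sdiff,
          Finset.mem_insert, Finset.mem_singleton] at hz ⊢
        by_cases hzx : z = x
        · simp [hzx]
        by_cases hzy : z = y
        · simp [hzy]
        have h₁ : c.pair z ≠ x := fun e => hzy (c.invol.injective (e.trans hy.symm))
        have h₂ : c.pair z ≠ y := fun e => hzx (c.invol.injective (e.trans h.symm))
        simp [hz, hzx, hzy, h₁, h₂]
    _ ≤ _ := (Finset.card_union_le _ _).trans (by gcongr; exact Finset.card_le_two)

/-- A family of configurations that match the points of `S` among themselves, and which is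
invariant under exchanging any two points outside `S`. -/
structure IsExchangeable (C : Finset (TConfig n d T)) (S : Finset (TPoint n d)) : Prop where
  pair_mem : ∀ c ∈ C, ∀ x ∈ S, c.pair x ∈ S
  conj_mem : ∀ c ∈ C, ∀ y ∉ S, ∀ z ∉ S, conj (Equiv.swap y z) c ∈ C

namespace IsExchangeable

variable {C : Finset (TConfig n d T)} {S : Finset (TPoint n d)}

open Classical in
theorem filter_pair (h : IsExchangeable C S) (x y : TPoint n d) :
    IsExchangeable (C.filter fun c => c.pair x = y) (S ∪ {x, y}) where
  pair_mem c hc z hz := by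
    obtain ⟨hc, hxy⟩ := Finset.mem_filter.1 hc
    have hyx : c.pair y = x := hxy ▸ c.invol x
    simp only [Finset.mem_union, Finset.mem_insert, Finset.mem_singleton] at hz ⊢
    rcases hz with hz | rfl | rfl
    · exact Or.inl (h.pair_mem c hc z hz)
    · simp [hxy]
    · simp [hyx]
  conj_mem c hc u hu v hv := by
    obtain ⟨hc, hxy⟩ := Finset.mem_filter.1 hc
    simp only [Finset.mem_union, Finset.mem_insert, Finset.mem_singleton, not_or] at hu hv
    refine Finset.mem_filter.2 ⟨h.conj_mem c hc u hu.1 v hv.1, ?_⟩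
    simp [conj, Equiv.swap_apply_of_ne_of_ne (Ne.symm hu.2.1) (Ne.symm hv.2.1), hxy,
      Equiv.swap_apply_of_ne_of_ne (Ne.symm hu.2.2) (Ne.symm hv.2.2)]

open Classical in
theorem card_filter_pair_le (h : IsExchangeable C S) {x y z : TPoint n d}
    (hy : y ∉ S) (hz : z ∉ S) (hxy : x ≠ y) (hxz : x ≠ z) :
    (C.filter fun c => c.pair x = y).card ≤ (C.filter fun c => c.pair x = z).card := by
  refine Finset.card_le_card_of_injOn (conj (Equiv.swap y z)) ?_ ?_
  · intro c hc
    obtain ⟨hc, hcx⟩ := Finset.mem_filter.1 hc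
    refine Finset.mem_filter.2 ⟨h.conj_mem c hc y hy z hz, ?_⟩
    simp [conj, Equiv.swap_apply_of_ne_of_ne hxy hxz, hcx]
  · exact (Function.LeftInverse.injective (conj_swap_conj_swap y z)).injOn

open Classical in
theorem card_compl_mul_card_filter_pair (h : IsExchangeable C S) {x y : TPoint n d}
    (hx : x ∉ S) (hy : y ∉ S) (hxy : x ≠ y) :
    (Sᶜ.card - 1) * (C.filter fun c => c.pair x = y).card = C.card := by
  have hmaps : ∀ c ∈ C, c.pair x ∈ Sᶜ.erase x := fun c hc => by
    refine Finset.mem_erase.2 ⟨c.nofix x, Finset.mem_compl.2 fun hS => hx ?_⟩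
    simpa [c.invol x] using h.pair_mem c hc _ hS
  rw [Finset.card_eq_sum_card_fiberwise hmaps, ← Finset.card_erase_of_mem (Finset.mem_compl.2 hx),
    ← smul_eq_mul, ← Finset.sum_const]
  refine Finset.sum_congr rfl fun z hz => ?_
  obtain ⟨hzx, hz⟩ := Finset.mem_erase.1 hz
  rw [Finset.mem_compl] at hz
  exact le_antisymm (h.card_filter_pair_le hy hz hxy hzx.symm)
    (h.card_filter_pair_le hz hy hzx.symm hxy)

open Classical in
theorem mul_card_filter_loopPoints_le (m : ℕ) (h : IsExchangeable C S)
    {A : Finset (TPoint n d)} (hA : Disjoint A S) :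
    2 ^ m * m.factorial * (∏ k ∈ Finset.range m, (Sᶜ.card - 2 * k - 1)) *
      (C.filter fun c => 2 * m ≤ (c.loopPoints A).card).card ≤
      A.card.descFactorial (2 * m) * C.card := by
  induction m generalizing C S A with
  | zero => simp
  | succ m ih =>
    set B := C.filter fun c => 2 * (m + 1) ≤ (c.loopPoints A).card with hB
    set K := 2 ^ m * m.factorial * ∏ k ∈ Finset.range m, (Sᶜ.card - 2 * (k + 1) - 1) with hK
    have hdouble : 2 * (m + 1) * B.card ≤
        ∑ p ∈ A.offDiag, (B.filter fun c => c.pair p.1 = p.2).card := by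
      calc 2 * (m + 1) * B.card = ∑ c ∈ B, 2 * (m + 1) := by
            rw [Finset.sum_const, smul_eq_mul, mul_comm]
        _ ≤ ∑ c ∈ B, (A.offDiag.filter fun p => c.pair p.1 = p.2).card :=
            Finset.sum_le_sum fun c hc =>
              (Finset.mem_filter.1 hc).2.trans (c.card_loopPoints_le_card_offDiag A)
        _ = _ := Finset.sum_card_bipartiteAbove_eq_sum_card_bipartiteBelow
            (fun (c : TConfig n d T) (p : TPoint n d × TPoint n d) => c.pair p.1 = p.2)
    have hterm : ∀ p ∈ A.offDiag, (Sᶜ.card - 1) * K *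
        (B.filter fun c => c.pair p.1 = p.2).card ≤
        (A.card - 2).descFactorial (2 * m) * C.card := by
      rintro ⟨x, y⟩ hp
      obtain ⟨hxA, hyA, hxy⟩ := Finset.mem_offDiag.1 hp
      have hxS : x ∉ S := Finset.disjoint_left.1 hA hxA
      have hyS : y ∉ S := Finset.disjoint_left.1 hA hyA
      have hdisj : Disjoint (A \ {x, y}) (S ∪ {x, y}) :=
        Finset.disjoint_union_right.2
          ⟨hA.mono_left Finset.sdiff_subset, Finset.sdiff_disjoint⟩
      have hcompl : (S ∪ {x, y})ᶜ.card = Sᶜ.card - 2 := by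
        rw [Finset.card_compl, Finset.card_compl, Finset.card_union_of_disjoint,
          Finset.card_pair hxy, Nat.sub_sub]
        simp [hxS, hyS]
      have hcard : (A \ {x, y}).card = A.card - 2 := by
        rw [Finset.card_sdiff_of_subset, Finset.card_pair hxy]
        simp [Finset.insert_subset_iff, hxA, hyA]
      have hsub : B.filter (fun c => c.pair x = y) ⊆
          (C.filter fun c => c.pair x = y).filter
            fun c => 2 * m ≤ (c.loopPoints (A \ {x, y})).card := by
        intro c hc
        simp only [hB, Finset.mem_filter] at hc ⊢
        have := c.card_loopPoints_le_sdiff A hc.2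
        exact ⟨⟨hc.1.1, hc.2⟩, by omega⟩
      have hrec := ih (h.filter_pair x y) hdisj
      have hprod : ∏ k ∈ Finset.range m, (Sᶜ.card - 2 - 2 * k - 1) =
          ∏ k ∈ Finset.range m, (Sᶜ.card - 2 * (k + 1) - 1) :=
        Finset.prod_congr rfl fun k _ => by omega
      rw [hcompl, hcard, hprod, ← hK] at hrec
      calc (Sᶜ.card - 1) * K * (B.filter fun c => c.pair x = y).card
          = (Sᶜ.card - 1) * (K * (B.filter fun c => c.pair x = y).card) := mul_assoc _ _ _
        _ ≤ (Sᶜ.card - 1) * ((A.card - 2).descFactorial (2 * m) *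
              (C.filter fun c => c.pair x = y).card) :=
            Nat.mul_le_mul_left _
              ((Nat.mul_le_mul_left _ (Finset.card_le_card hsub)).trans hrec)
        _ = (A.card - 2).descFactorial (2 * m) * C.card := by
            rw [← h.card_compl_mul_card_filter_pair hxS hyS hxy]; ring
    have hdesc : A.card.descFactorial (2 * (m + 1)) =
        (A.card * A.card - A.card) * (A.card - 2).descFactorial (2 * m) := by
      rcases A.card with _ | _ | a
      · simp [mul_add]
      · simp [mul_add, Nat.descFactorial]
      · rw [mul_add, mul_one, Nat.succ_descFactorial_succ, Nat.succ_descFactorial_succ,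
          ← mul_assoc, ← Nat.mul_sub_one]
        rfl
    calc 2 ^ (m + 1) * (m + 1).factorial *
          (∏ k ∈ Finset.range (m + 1), (Sᶜ.card - 2 * k - 1)) * B.card
        = (Sᶜ.card - 1) * K * (2 * (m + 1) * B.card) := by
          rw [Finset.prod_range_succ', Nat.factorial_succ, hK]
          simp only [mul_zero, Nat.sub_zero]
          ring
      _ ≤ (Sᶜ.card - 1) * K * ∑ p ∈ A.offDiag, (B.filter fun c => c.pair p.1 = p.2).card :=
          Nat.mul_le_mul_left _ hdouble
      _ ≤ ∑ p ∈ A.offDiag, (A.card - 2).descFactorial (2 * m) * C.card := by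
          rw [Finset.mul_sum]; exact Finset.sum_le_sum hterm
      _ = A.card.descFactorial (2 * (m + 1)) * C.card := by
          rw [Finset.sum_const, Finset.offDiag_card, smul_eq_mul, hdesc, mul_assoc]

end IsExchangeable

open Classical in
theorem mul_card_loops_le (m : ℕ) (i : Fin n) :
    2 ^ m * m.factorial * (∏ k ∈ Finset.range m, ((∑ j, d j) - 2 * k - 1)) *
      Nat.card {c : TConfig n d T //
        2 * m ≤ Nat.card {x : TPoint n d // x.1 = i ∧ (c.pair x).1 = i}} ≤
      (d i).descFactorial (2 * m) * Nat.card (TConfig n d T) := by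
  have : Fintype (TConfig n d T) := Fintype.ofFinite _
  have hA : (Finset.univ.filter fun x : TPoint n d => x.1 = i).card = d i := by
    rw [← Fintype.card_subtype, Fintype.card_congr (Equiv.sigmaSubtype i)]
    simp
  have hloops (c : TConfig n d T) :
      Nat.card {x : TPoint n d // x.1 = i ∧ (c.pair x).1 = i} =
        (c.loopPoints (Finset.univ.filter fun x => x.1 = i)).card := by
    rw [Nat.card_eq_fintype_card, Fintype.card_subtype, loopPoints, Finset.filter_filter]
    simp
  have huniv : IsExchangeable (Finset.univ : Finset (TConfig n d T)) ∅ := ⟨by simp, by simp⟩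
  have := huniv.mul_card_filter_loopPoints_le m
    (Finset.disjoint_empty_right (Finset.univ.filter fun x : TPoint n d => x.1 = i))
  simp only [hloops]
  rw [Nat.card_eq_fintype_card, Fintype.card_subtype, Nat.card_eq_fintype_card]
  simpa [hA] using this

end TConfig

/-- The expected number of indices `i` such that at least `m` matched pairs of a uniformly
random temporal configuration have both points in cell `i` (nodes incident with at least
`m` loops) is at most `M_{2m} / (2^m · m! · ∏_{k=0}^{m-1} (M - 2k - 1))`.  A cell has at
least `m` loops iff at least `2m` of its points `x` satisfy `(pair x).1 = x.1`. -/
theorem stmt8 (n T : ℕ) (d : Fin n → ℕ) (M m : ℕ) (hM : M = ∑ i, d i)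
    (hEven : Even M) (hm : 1 ≤ m) (hmM : 2 * m ≤ M) (hT : 1 ≤ T) :
    (Nat.card {p : TConfig n d T × Fin n //
        2 * m ≤ Nat.card {x : TPoint n d // x.1 = p.2 ∧ (p.1.pair x).1 = p.2}} : ℝ) /
      Nat.card (TConfig n d T) ≤
    (∑ i, ((d i).descFactorial (2 * m) : ℝ)) /
      (2 ^ m * (m.factorial : ℝ) * ∏ k ∈ Finset.range m, ((M : ℝ) - 2 * (k : ℝ) - 1)) := by
  have hcard : Nat.card {p : TConfig n d T × Fin n //
        2 * m ≤ Nat.card {x : TPoint n d // x.1 = p.2 ∧ (p.1.pair x).1 = p.2}} =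
      ∑ i, Nat.card {c : TConfig n d T //
        2 * m ≤ Nat.card {x : TPoint n d // x.1 = i ∧ (c.pair x).1 = i}} := by
    rw [← Nat.card_sigma]
    exact Nat.card_congr
      { toFun := fun p => ⟨p.1.2, p.1.1, p.2⟩
        invFun := fun p => ⟨(p.2.1, p.1), p.2.2⟩
        left_inv := fun _ => rfl
        right_inv := fun _ => rfl }
  have hprod : ∏ k ∈ Finset.range m, ((M : ℝ) - 2 * (k : ℝ) - 1) =
      ((∏ k ∈ Finset.range m, (M - 2 * k - 1) : ℕ) : ℝ) := by
    rw [Nat.cast_prod]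
    refine Finset.prod_congr rfl fun k hk => ?_
    have := Finset.mem_range.1 hk
    rw [Nat.sub_sub, Nat.cast_sub (by omega)]
    push_cast
    ring
  have hpos : 0 < ∏ k ∈ Finset.range m, (M - 2 * k - 1) :=
    Finset.prod_pos fun k hk => by
      have := Finset.mem_range.1 hk
      omega
  rw [hprod, hcard]
  rcases Nat.eq_zero_or_pos (Nat.card (TConfig n d T)) with hN | hN
  · rw [hN, Nat.cast_zero, div_zero]
    positivity
  rw [div_le_div_iff₀ (by exact_mod_cast hN) (by positivity)]
  have hsum := Finset.sum_le_sum fun i (_ : i ∈ Finset.univ) =>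
    TConfig.mul_card_loops_le (d := d) (T := T) m i
  rw [← Finset.mul_sum, ← Finset.sum_mul, ← hM, mul_comm] at hsum
  exact_mod_cast hsum
end

section
/- Let ε > 0 be a real constant, κ = ⌊1 + 1/ε⌋, and let Δ : ℕ → ℕ satisfy Δ(M)^{2+ε} = O(M) as M → ∞. Then the sum Σ_{m=κ+1}^{⌊Δ(M)/2⌋} Δ(M)^{2m−1} / M^{m−1} tends to 0 as M → ∞ (with the sum interpreted as 0 when κ + 1 > ⌊Δ(M)/2⌋). -/
open Filter Asymptotics

theorem sum_Icc_pow_div_pow_le {d M : ℝ} (hd : 0 ≤ d) (hM : 0 ≤ M) (hr : d ^ 2 / M < 1)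
    (k n : ℕ) :
    ∑ m ∈ Finset.Icc (k + 1) n, d ^ (2 * m - 1) / M ^ (m - 1) ≤
      d * (d ^ 2 / M) ^ k / (1 - d ^ 2 / M) := by
  have hIcc : Finset.Icc (k + 1) n = Finset.Ico (k + 1) (n + 1) := by
    ext m
    simp
  rw [hIcc, ← Finset.sum_Ico_add' (fun m => d ^ (2 * m - 1) / M ^ (m - 1)) k n 1, mul_div_assoc]
  calc ∑ m ∈ Finset.Ico k n, d ^ (2 * (m + 1) - 1) / M ^ (m + 1 - 1)
      = d * ∑ m ∈ Finset.Ico k n, (d ^ 2 / M) ^ m := by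
        rw [Finset.mul_sum]
        refine Finset.sum_congr rfl fun m _ => ?_
        rw [show 2 * (m + 1) - 1 = 2 * m + 1 by omega, Nat.add_sub_cancel, div_pow, ← pow_mul,
          pow_succ']
        ring
    _ ≤ d * ((d ^ 2 / M) ^ k / (1 - d ^ 2 / M)) := by
        gcongr
        exact geom_sum_Ico_le_of_lt_one (by positivity) hr

theorem tendsto_natCast_rpow_atTop_nhds_zero {a : ℝ} (ha : a < 0) :
    Tendsto (fun M : ℕ => (M : ℝ) ^ a) atTop (nhds 0) := by
  simpa [Function.comp_def] using (tendsto_rpow_neg_atTop (neg_pos.2 ha)).comp tendsto_natCast_atTop_atTop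

/-- If `ε > 0`, `κ = ⌊1 + 1/ε⌋` and `Δ(M)^{2+ε} = O(M)` as `M → ∞`, then
`Σ_{m=κ+1}^{⌊Δ(M)/2⌋} Δ(M)^{2m-1} / M^{m-1} → 0` as `M → ∞` (the sum being `0` when
`κ + 1 > ⌊Δ(M)/2⌋`). -/
theorem stmt12 (ε : ℝ) (hε : 0 < ε) (κ : ℕ) (hκ : κ = Nat.floor (1 + 1 / ε))
    (Δ : ℕ → ℕ)
    (hO : (fun M : ℕ => (Δ M : ℝ) ^ ((2 : ℝ) + ε)) =O[atTop] fun M : ℕ => (M : ℝ)) :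
    Tendsto (fun M : ℕ => ∑ m ∈ Finset.Icc (κ + 1) (Δ M / 2),
        (Δ M : ℝ) ^ (2 * m - 1) / (M : ℝ) ^ (m - 1)) atTop (nhds 0) := by
  have hκε : 1 < κ * ε := by
    have h := Nat.lt_floor_add_one (1 + 1 / ε)
    rw [← hκ] at h
    exact (div_lt_iff₀ hε).1 (by linarith)
  have hΔ : (fun M : ℕ => (Δ M : ℝ)) =O[atTop] fun M : ℕ => (M : ℝ) ^ (1 / (2 + ε)) := by
    refine (hO.rpow (r := 1 / (2 + ε)) (by positivity)
      (Eventually.of_forall fun M => Nat.cast_nonneg M)).congr_left fun M => ?_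
    rw [← Real.rpow_mul (Nat.cast_nonneg _), mul_one_div_cancel (by positivity), Real.rpow_one]
  have hrO : (fun M : ℕ => (Δ M : ℝ) ^ 2 / M) =O[atTop]
      fun M : ℕ => (M : ℝ) ^ (-ε / (2 + ε)) := by
    refine ((hΔ.pow 2).mul (isBigO_refl (fun M : ℕ => (M : ℝ)⁻¹) atTop)).congr' ?_ ?_
    · exact Eventually.of_forall fun M => (div_eq_mul_inv _ _).symm
    · filter_upwards [eventually_gt_atTop 0] with M hM
      have hM' : (0 : ℝ) < M := Nat.cast_pos.2 hM
      rw [← Real.rpow_natCast, ← Real.rpow_mul hM'.le, ← Real.rpow_neg_one, ← Real.rpow_add hM']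
      congr 1
      push_cast
      field_simp
      ring
  have hr : Tendsto (fun M : ℕ => (Δ M : ℝ) ^ 2 / M) atTop (nhds 0) :=
    hrO.trans_tendsto (tendsto_natCast_rpow_atTop_nhds_zero
      (div_neg_of_neg_of_pos (by linarith) (by linarith)))
  have hfirstO : (fun M : ℕ => (Δ M : ℝ) * ((Δ M : ℝ) ^ 2 / M) ^ κ) =O[atTop]
      fun M : ℕ => (M : ℝ) ^ ((1 - κ * ε) / (2 + ε)) := by
    refine (hΔ.mul (hrO.pow κ)).congr' EventuallyEq.rfl ?_
    filter_upwards [eventually_gt_atTop 0] with M hM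
    have hM' : (0 : ℝ) < M := Nat.cast_pos.2 hM
    rw [← Real.rpow_natCast, ← Real.rpow_mul hM'.le, ← Real.rpow_add hM']
    congr 1
    field_simp
    ring
  have hfirst : Tendsto (fun M : ℕ => (Δ M : ℝ) * ((Δ M : ℝ) ^ 2 / M) ^ κ) atTop (nhds 0) :=
    hfirstO.trans_tendsto (tendsto_natCast_rpow_atTop_nhds_zero
      (div_neg_of_neg_of_pos (by linarith) (by linarith)))
  have hbound : Tendsto
      (fun M : ℕ => (Δ M : ℝ) * ((Δ M : ℝ) ^ 2 / M) ^ κ / (1 - (Δ M : ℝ) ^ 2 / M))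
      atTop (nhds 0) := by
    simpa [Pi.div_def] using hfirst.div (tendsto_const_nhds.sub hr) (by norm_num : (1 : ℝ) - 0 ≠ 0)
  refine squeeze_zero' (Eventually.of_forall fun M => by positivity) ?_ hbound
  filter_upwards [hr.eventually_lt_const one_pos] with M hM
  exact sum_Icc_pow_div_pow_le (Nat.cast_nonneg _) (Nat.cast_nonneg _) hM κ _
end

section
/- Let ε > 0 be a real constant, η = ⌊2 + 2/ε⌋, and let Δ : ℕ → ℕ satisfy Δ(M)^{2+ε} = O(M) as M → ∞. Then the sum Σ_{m=η+1}^{Δ(M)} Δ(M)^{2m−2} / M^{m−2} tends to 0 as M → ∞ (with the sum interpreted as 0 when η + 1 > Δ(M)). -/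
open Filter Asymptotics

/-- A finite geometric sum with ratio `x ≤ 1 / 2`, starting at exponent `k`, is at most
`2 * x ^ k`. -/
lemma sum_Icc_geometric_le {x : ℝ} (hx : 0 ≤ x) (hx' : x ≤ 1 / 2) {k c : ℕ} (n : ℕ) :
    ∑ m ∈ Finset.Icc (k + c) n, x ^ (m - c) ≤ 2 * x ^ k := by
  have hIcc : Finset.Icc (k + c) n = Finset.Ico (k + c) (n + 1) := by
    ext m
    simp only [Finset.mem_Icc, Finset.mem_Ico]
    omega
  rw [hIcc, Finset.sum_Ico_eq_sum_range]
  have hterm (i : ℕ) : x ^ (k + c + i - c) = x ^ k * x ^ i := by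
    rw [← pow_add]
    congr 1
    omega
  simp only [hterm]
  rw [← Finset.mul_sum, Finset.range_eq_Ico, mul_comm]
  gcongr
  refine (geom_sum_Ico_le_of_lt_one hx (by linarith)).trans ?_
  rw [pow_zero, div_le_iff₀ (by linarith)]
  linarith

/-- If `ε > 0`, `η = ⌊2 + 2/ε⌋` and `Δ(M)^{2+ε} = O(M)` as `M → ∞`, then
`Σ_{m=η+1}^{Δ(M)} Δ(M)^{2m-2} / M^{m-2} → 0` as `M → ∞` (the sum being `0` when
`η + 1 > Δ(M)`). -/
theorem stmt13 (ε : ℝ) (hε : 0 < ε) (η : ℕ) (hη : η = Nat.floor (2 + 2 / ε))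
    (Δ : ℕ → ℕ)
    (hO : (fun M : ℕ => (Δ M : ℝ) ^ ((2 : ℝ) + ε)) =O[atTop] fun M : ℕ => (M : ℝ)) :
    Tendsto (fun M : ℕ => ∑ m ∈ Finset.Icc (η + 1) (Δ M),
        (Δ M : ℝ) ^ (2 * m - 2) / (M : ℝ) ^ (m - 2)) atTop (nhds 0) := by
  have hη_two : 2 ≤ η := by
    rw [hη]
    exact Nat.le_floor (by push_cast; linarith [div_pos two_pos hε])
  obtain ⟨k, rfl⟩ : ∃ k, η = k + 1 := ⟨η - 1, by omega⟩
  have hk : 2 < ε * k := by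
    have h := Nat.lt_floor_add_one (2 + 2 / ε)
    rw [← hη] at h
    push_cast at h
    have h' : 2 / ε < k := by linarith
    rwa [div_lt_iff₀' hε] at h'
  set a : ℝ := 2 / (2 + ε) with ha
  have hε' : (0 : ℝ) < 2 + ε := by linarith
  have hsq : (fun M : ℕ => (Δ M : ℝ) ^ 2) =O[atTop] fun M : ℕ => (M : ℝ) ^ a := by
    refine (hO.rpow (r := a) (by positivity) (.of_forall fun M => by positivity)).congr_left
      fun M => ?_
    rw [← Real.rpow_mul (by positivity), ha, mul_div_cancel₀ _ hε'.ne', Real.rpow_two]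
  have hratio : (fun M : ℕ => (Δ M : ℝ) ^ 2 / M) =O[atTop] fun M : ℕ => (M : ℝ) ^ (a - 1) := by
    refine (hsq.mul (isBigO_refl (fun M : ℕ => (M : ℝ)⁻¹) atTop)).congr' ?_ ?_
    · exact .of_forall fun M => (div_eq_mul_inv _ _).symm
    · filter_upwards [eventually_gt_atTop 0] with M hM
      rw [Real.rpow_sub_one (by positivity), div_eq_mul_inv]
  have hdecay {b : ℝ} (hb : b < 0) : Tendsto (fun M : ℕ => (M : ℝ) ^ b) atTop (nhds 0) := by
    simpa [Function.comp_def] using (tendsto_rpow_neg_atTop (neg_pos.2 hb)).comp tendsto_natCast_atTop_atTop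
  have ha_one : a - 1 < 0 := by
    rw [ha, sub_neg, div_lt_one hε']
    linarith
  have hexp : a + (a - 1) * k < 0 := by
    have : a + (a - 1) * k = (2 - ε * k) / (2 + ε) := by
      rw [ha]
      field_simp
      ring
    rw [this]
    exact div_neg_of_neg_of_pos (by linarith) hε'
  have hlead : Tendsto (fun M : ℕ => (Δ M : ℝ) ^ 2 * ((Δ M : ℝ) ^ 2 / M) ^ k) atTop
      (nhds 0) := by
    refine ((hsq.mul (hratio.pow k)).congr' .rfl ?_).trans_tendsto (hdecay hexp)
    filter_upwards [eventually_gt_atTop 0] with M hM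
    rw [Real.rpow_add (by positivity), Real.rpow_mul_natCast (by positivity)]
  have hsmall : ∀ᶠ M : ℕ in atTop, (Δ M : ℝ) ^ 2 / M ≤ 1 / 2 :=
    (hratio.trans_tendsto (hdecay ha_one)).eventually_le_const (by norm_num)
  refine squeeze_zero' (.of_forall fun M => by positivity) ?_
    (by simpa using hlead.const_mul 2)
  filter_upwards [hsmall] with M hM
  calc ∑ m ∈ Finset.Icc (k + 1 + 1) (Δ M), (Δ M : ℝ) ^ (2 * m - 2) / (M : ℝ) ^ (m - 2)
      = (Δ M : ℝ) ^ 2 * ∑ m ∈ Finset.Icc (k + 2) (Δ M), ((Δ M : ℝ) ^ 2 / M) ^ (m - 2) := by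
        rw [Finset.mul_sum]
        refine Finset.sum_congr rfl fun m hm => ?_
        have hm' : k + 2 ≤ m := (Finset.mem_Icc.1 hm).1
        rw [div_pow, ← mul_div_assoc, ← pow_mul, ← pow_add]
        congr 2
        omega
    _ ≤ (Δ M : ℝ) ^ 2 * (2 * ((Δ M : ℝ) ^ 2 / M) ^ k) := by
        gcongr
        exact sum_Icc_geometric_le (by positivity) hM _
    _ = 2 * ((Δ M : ℝ) ^ 2 * ((Δ M : ℝ) ^ 2 / M) ^ k) := by ring
end
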